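/- Let (n_k)_{k ≥ 1} be a sequence of distinct positive integers. Then for Lebesgue-almost all x ∈ [0,1], the sequence of fractional parts (⟨n_k x⟩)_{k ≥ 1} is uniformly distributed modulo 1. -/

import Mathlib

open MeasureTheory Filter

/-- A sequence `(u k)_{k ≥ 1}` of reals in `[0,1)` is uniformly distributed modulo 1 if for all
`0 ≤ a < b ≤ 1` the proportion of the first `N` terms lying in `[a,b)` tends to `b - a`. -/
def UnifDistribMod1 (u : ℕ → ℝ) : Prop :=
  ∀ a b : ℝ, 0 ≤ a → a < b → b ≤ 1 →
    Tendsto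
      (fun N : ℕ =>
        (∑ k ∈ Finset.Icc 1 N, (Set.Ico a b).indicator (fun _ => (1 : ℝ)) (u k)) / N)
      atTop (nhds (b - a))

open scoped Topology ENNReal
open AddCircle Finset

/-- If the averages of a bounded sequence tend to zero along the squares, they tend to zero. -/
lemma tendsto_average_of_tendsto_average_sq {c : ℕ → ℂ} (hc : ∀ k, ‖c k‖ ≤ 1)
    (h : Tendsto (fun j : ℕ => (∑ k ∈ Icc 1 ((j + 1) ^ 2), c k) / ((j : ℂ) + 1) ^ 2)
      atTop (𝓝 0)) :
    Tendsto (fun N : ℕ => (∑ k ∈ Icc 1 N, c k) / (N : ℂ)) atTop (𝓝 0) := by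
  have hsqrt : Tendsto Nat.sqrt atTop atTop :=
    tendsto_atTop.2 fun b => by
      filter_upwards [eventually_ge_atTop (b * b)] with N hN using Nat.le_sqrt.2 hN
  have h' : Tendsto (fun j : ℕ => (∑ k ∈ Icc 1 (j ^ 2), c k) / (j : ℂ) ^ 2) atTop (𝓝 0) :=
    (tendsto_add_atTop_iff_nat 1).1 (by simpa using h)
  have hbound : Tendsto (fun j : ℕ => ‖(∑ k ∈ Icc 1 (j ^ 2), c k) / (j : ℂ) ^ 2‖ + 2 * (j : ℝ)⁻¹)
      atTop (𝓝 0) := by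
    simpa using h'.norm.add (tendsto_inv_atTop_nhds_zero_nat (𝕜 := ℝ) |>.const_mul 2)
  refine squeeze_zero_norm' ?_ (hbound.comp hsqrt)
  filter_upwards [eventually_ge_atTop 1] with N hN
  obtain ⟨j, hj⟩ : ∃ j, j = Nat.sqrt N := ⟨_, rfl⟩
  have hj0 : 0 < j := hj ▸ Nat.sqrt_pos.2 hN
  have hjN : j ^ 2 ≤ N := by rw [hj]; exact Nat.sqrt_le' N
  have hNj : N ≤ j ^ 2 + 2 * j := by
    have := Nat.sqrt_le_add N
    rw [← hj] at this
    nlinarith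
  have hj' : (0 : ℝ) < j := by exact_mod_cast hj0
  have hN' : (0 : ℝ) < N := by exact_mod_cast hN
  have hsplit : ∑ k ∈ Icc 1 N, c k = ∑ k ∈ Icc 1 (j ^ 2), c k + ∑ k ∈ Ioc (j ^ 2) N, c k := by
    rw [← sum_union]
    · congr 1
      ext k
      simp only [mem_Icc, mem_union, mem_Ioc]
      omega
    · rw [disjoint_left]
      intro k
      simp only [mem_Icc, mem_Ioc]
      omega
  have htail : ‖∑ k ∈ Ioc (j ^ 2) N, c k‖ ≤ 2 * j := by
    refine (norm_sum_le_of_le _ fun k _ => hc k).trans ?_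
    simp only [sum_const, Nat.card_Ioc, nsmul_eq_mul, mul_one]
    exact_mod_cast (by omega : N - j ^ 2 ≤ 2 * j)
  have hjNr : (j : ℝ) ^ 2 ≤ N := by exact_mod_cast hjN
  simp only [Function.comp_apply, ← hj, norm_div, norm_pow, Complex.norm_natCast]
  calc ‖∑ k ∈ Icc 1 N, c k‖ / N ≤ (‖∑ k ∈ Icc 1 (j ^ 2), c k‖ + 2 * j) / N := by
        gcongr
        rw [hsplit]
        exact (norm_add_le _ _).trans (by gcongr)
    _ ≤ (‖∑ k ∈ Icc 1 (j ^ 2), c k‖ + 2 * j) / (j : ℝ) ^ 2 := by gcongr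
    _ = _ := by field_simp

lemma integral_norm_sq_sum_fourier {m : ℕ → ℤ} {s : Finset ℕ} (hm : Set.InjOn m s) :
    ∫ t : UnitAddCircle, ‖∑ k ∈ s, fourier (m k) t‖ ^ 2 ∂haarAddCircle = #s := by
  classical
  have key := ContinuousMap.inner_toLp (𝕜 := ℂ) (haarAddCircle (T := 1))
    (∑ k ∈ s, fourier (m k)) (∑ k ∈ s, fourier (m k))
  have hsum : ContinuousMap.toLp (E := ℂ) 2 (haarAddCircle (T := 1)) ℂ (∑ k ∈ s, fourier (m k)) =
      ∑ i ∈ s.image m, (1 : ℂ) • fourierLp (T := 1) 2 i := by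
    rw [map_sum, sum_image hm]
    simp
  rw [hsum, orthonormal_fourier.inner_sum] at key
  simp only [map_one, mul_one, sum_const, card_image_of_injOn hm, nsmul_eq_mul,
    RCLike.mul_conj, ContinuousMap.coe_sum, Finset.sum_apply] at key
  have : ((∫ t : UnitAddCircle, ‖∑ k ∈ s, fourier (m k) t‖ ^ 2 ∂haarAddCircle : ℝ) : ℂ) = #s := by
    rw [key, ← integral_complex_ofReal]
    simp
  exact_mod_cast this

/-- A sequence of nonnegative functions with summable integrals tends to zero almost everywhere. -/
lemma ae_tendsto_zero_of_summable_integral {α : Type*} [MeasurableSpace α] {μ : Measure α}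
    {f : ℕ → α → ℝ} (hf : ∀ j, Integrable (f j) μ) (hf0 : ∀ j t, 0 ≤ f j t)
    (hsum : Summable fun j => ∫ t, f j t ∂μ) :
    ∀ᵐ t ∂μ, Tendsto (fun j => f j t) atTop (𝓝 0) := by
  have hmeas : ∀ j, AEMeasurable (fun t => ENNReal.ofReal (f j t)) μ :=
    fun j => (hf j).aemeasurable.ennreal_ofReal
  have hfin : ∫⁻ t, ∑' j, ENNReal.ofReal (f j t) ∂μ ≠ ∞ := by
    rw [lintegral_tsum hmeas]
    simp_rw [← fun j => ofReal_integral_eq_lintegral_ofReal (hf j) (ae_of_all μ (hf0 j))]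
    exact hsum.tsum_ofReal_ne_top
  filter_upwards [ae_lt_top' (AEMeasurable.tsum hmeas) hfin] with t ht
  have := ENNReal.tendsto_atTop_zero_of_tsum_ne_top ht.ne
  have := (ENNReal.tendsto_toReal ENNReal.zero_ne_top).comp this
  simpa [Function.comp_def, ENNReal.toReal_ofReal, hf0] using this

/-- For distinct frequencies, the averages of the characters tend to zero almost everywhere. -/
lemma ae_tendsto_average_fourier {m : ℕ → ℤ} (hm : Set.InjOn m (Set.Ici 1)) :
    ∀ᵐ t : UnitAddCircle ∂haarAddCircle,
      Tendsto (fun N : ℕ => (∑ k ∈ Icc 1 N, fourier (m k) t) / (N : ℂ)) atTop (𝓝 0) := by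
  have hint : ∀ j : ℕ, ∫ t : UnitAddCircle,
      ‖(∑ k ∈ Icc 1 ((j + 1) ^ 2), fourier (m k) t) / ((j : ℂ) + 1) ^ 2‖ ^ 2 ∂haarAddCircle =
        1 / ((j : ℝ) + 1) ^ 2 := by
    intro j
    have hn : ‖(j : ℂ) + 1‖ = (j : ℝ) + 1 := by
      exact_mod_cast Complex.norm_natCast (j + 1)
    simp only [norm_div, norm_pow, div_pow, hn]
    rw [integral_div, integral_norm_sq_sum_fourier
      (hm.mono fun k hk => (mem_Icc.1 (mem_coe.1 hk)).1)]
    simp only [Nat.card_Icc, add_tsub_cancel_right]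
    push_cast
    have : (j : ℝ) + 1 ≠ 0 := by positivity
    field_simp
  have := ae_tendsto_zero_of_summable_integral (μ := haarAddCircle (T := 1))
    (f := fun j t => ‖(∑ k ∈ Icc 1 ((j + 1) ^ 2), fourier (m k) t) / ((j : ℂ) + 1) ^ 2‖ ^ 2)
    (fun j => (by fun_prop : Continuous _).integrable_of_hasCompactSupport
      (HasCompactSupport.of_compactSpace _))
    (fun j t => by positivity)
    (by
      simp_rw [hint]
      exact_mod_cast (summable_nat_add_iff 1).2 (Real.summable_one_div_nat_pow.2 one_lt_two))
  filter_upwards [this] with t ht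
  refine tendsto_average_of_tendsto_average_sq (fun k => ?_) ?_
  · rw [fourier_apply, Circle.norm_coe]
  · rw [tendsto_zero_iff_norm_tendsto_zero]
    simpa only [Real.sqrt_sq (norm_nonneg _), Real.sqrt_zero] using ht.sqrt

/-- The empirical measure of the first `N + 1` terms of a sequence indexed from `1`. -/
noncomputable def empiricalMeasure {α : Type*} [MeasurableSpace α] (u : ℕ → α) (N : ℕ) :
    ProbabilityMeasure α :=
  ⟨((N : ℝ≥0∞) + 1)⁻¹ • ∑ k ∈ Icc 1 (N + 1), Measure.dirac (u k), ⟨by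
    simp [ENNReal.inv_mul_cancel]⟩⟩

lemma integral_empiricalMeasure {α : Type*} [MeasurableSpace α] [TopologicalSpace α]
    [OpensMeasurableSpace α] [CompactSpace α] (u : ℕ → α) (N : ℕ) (f : C(α, ℂ)) :
    ∫ t, f t ∂(empiricalMeasure u N : Measure α) =
      (∑ k ∈ Icc 1 (N + 1), f (u k)) / ((N + 1 : ℕ) : ℂ) := by
  have hf : StronglyMeasurable f := f.continuous.stronglyMeasurable
  have hr : (((N : ℝ≥0∞) + 1)⁻¹).toReal = ((N : ℝ) + 1)⁻¹ := by
    rw [ENNReal.toReal_inv, ENNReal.toReal_add (by simp) (by simp)]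
    simp
  simp only [empiricalMeasure, ProbabilityMeasure.coe_mk]
  rw [integral_smul_measure, integral_finsetSum_measure
    fun k _ => integrable_dirac' hf (by simp), hr]
  simp_rw [integral_dirac' f _ hf]
  rw [Complex.real_smul]
  push_cast
  rw [div_eq_inv_mul]

/-- **Weyl's criterion**: if the averages of all nontrivial characters along a sequence in the
circle tend to zero, the empirical measures of the sequence converge weakly to Haar measure. -/
lemma tendsto_empiricalMeasure_haarAddCircle {u : ℕ → UnitAddCircle}
    (h : ∀ m : ℤ, m ≠ 0 →
      Tendsto (fun N : ℕ => (∑ k ∈ Icc 1 N, fourier m (u k)) / (N : ℂ)) atTop (𝓝 0)) :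
    Tendsto (empiricalMeasure u) atTop (𝓝 ⟨haarAddCircle, inferInstance⟩) := by
  refine ProbabilityMeasure.tendsto_of_tight_of_separatesPoints ℂ
    (A := fourierSubalgebra.comap (BoundedContinuousFunction.toContinuousMapStarₐ ℂ)) ?_ ?_ ?_
  · rw [isTightMeasureSet_iff_exists_isCompact_measure_compl_le]
    exact fun ε _ => ⟨Set.univ, isCompact_univ, by simp⟩
  · intro x y hxy
    obtain ⟨_, ⟨g, hg, rfl⟩, hgxy⟩ := fourierSubalgebra_separatesPoints hxy
    exact ⟨g, ⟨g, ⟨BoundedContinuousFunction.mkOfCompact g, hg, rfl⟩, rfl⟩, hgxy⟩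
  · intro g hg
    have hspan : g.toContinuousMap ∈ Submodule.span ℂ (Set.range (fourier (T := 1))) := by
      rw [← fourierSubalgebra_coe]
      exact hg
    suffices ∀ f : C(UnitAddCircle, ℂ), f ∈ Submodule.span ℂ (Set.range (fourier (T := 1))) →
        Tendsto (fun N => ∫ t, f t ∂(empiricalMeasure u N : Measure UnitAddCircle)) atTop
          (𝓝 (∫ t, f t ∂haarAddCircle)) from this _ hspan
    intro f hf
    have hint (μ : Measure UnitAddCircle) [IsFiniteMeasure μ] (f : C(UnitAddCircle, ℂ)) :
        Integrable f μ :=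
      f.continuous.integrable_of_hasCompactSupport (HasCompactSupport.of_compactSpace _)
    induction hf using Submodule.span_induction with
    | mem f hf =>
      obtain ⟨m, rfl⟩ := hf
      rcases eq_or_ne m 0 with rfl | hm
      · simp
      · have h0 : ∫ t : UnitAddCircle, fourier m t ∂haarAddCircle = 0 := by
          have : inner ℂ (fourierLp (T := 1) 2 0) (fourierLp 2 m) = 0 :=
            orthonormal_fourier.2 hm.symm
          rw [ContinuousMap.inner_toLp] at this
          simpa using this
        simp_rw [integral_empiricalMeasure, h0]
        exact (tendsto_add_atTop_iff_nat 1).2 (h m hm)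
    | zero => simp
    | add f g _ _ hf hg =>
      simp only [ContinuousMap.add_apply]
      rw [integral_add (hint _ f) (hint _ g)]
      simp_rw [fun N => integral_add (hint (empiricalMeasure u N : Measure UnitAddCircle) f)
        (hint _ g)]
      exact hf.add hg
    | smul c f _ hf =>
      simp only [ContinuousMap.smul_apply, integral_smul]
      exact hf.const_smul c

/-- Under Weyl's criterion, the proportion of terms in a set with null boundary tends to its
Haar measure. -/
lemma tendsto_average_indicator {u : ℕ → UnitAddCircle}
    (h : ∀ m : ℤ, m ≠ 0 →
      Tendsto (fun N : ℕ => (∑ k ∈ Icc 1 N, fourier m (u k)) / (N : ℂ)) atTop (𝓝 0))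
    {E : Set UnitAddCircle} (hE : MeasurableSet E) (hfr : haarAddCircle (frontier E) = 0) :
    Tendsto (fun N : ℕ => (∑ k ∈ Icc 1 N, E.indicator (fun _ => (1 : ℝ)) (u k)) / N) atTop
      (𝓝 (haarAddCircle.real E)) := by
  have hconv := ProbabilityMeasure.tendsto_measure_of_null_frontier_of_tendsto'
    (tendsto_empiricalMeasure_haarAddCircle h) hfr
  have := (ENNReal.tendsto_toReal (measure_ne_top (haarAddCircle (T := 1)) E)).comp hconv
  refine (tendsto_add_atTop_iff_nat 1).1 (this.congr fun N => ?_)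
  simp only [Function.comp_apply, empiricalMeasure, ProbabilityMeasure.coe_mk,
    Measure.smul_apply, Measure.finsetSum_apply, Measure.dirac_apply' _ hE, smul_eq_mul,
    ENNReal.toReal_mul, ENNReal.toReal_inv]
  rw [ENNReal.toReal_add (by simp) (by simp), ENNReal.toReal_sum, div_eq_inv_mul]
  · have hind : ∀ t, (E.indicator (1 : UnitAddCircle → ℝ≥0∞) t).toReal =
        E.indicator (fun _ => (1 : ℝ)) t := fun t => by
      by_cases ht : t ∈ E <;> simp [ht]
    simp [hind]
  · intro k _
    by_cases hk : u k ∈ E <;> simp [hk]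

lemma haarAddCircle_eq_volume : (haarAddCircle : Measure UnitAddCircle) = volume := by
  simp [volume_eq_smul_haarAddCircle]

lemma coe_mem_image_iff_fract_mem {s : Set ℝ} (hs : s ⊆ Set.Ico 0 1) (y : ℝ) :
    (y : UnitAddCircle) ∈ ((↑) : ℝ → UnitAddCircle) '' s ↔ Int.fract y ∈ s := by
  refine ⟨?_, fun h => ⟨_, h, coe_fract y⟩⟩
  rintro ⟨z, hz, hzy⟩
  rw [← coe_fract y, coe_eq_coe_iff_of_mem_Ico (a := 0) (by simpa using hs hz)
    (by simp [Int.fract_nonneg, Int.fract_lt_one])] at hzy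
  exact hzy ▸ hz

lemma isCompact_image_Icc (a b : ℝ) :
    IsCompact (((↑) : ℝ → UnitAddCircle) '' Set.Icc a b) :=
  isCompact_Icc.image (AddCircle.continuous_mk' 1)

lemma isOpen_image_Ioo (a b : ℝ) : IsOpen (((↑) : ℝ → UnitAddCircle) '' Set.Ioo a b) :=
  QuotientAddGroup.isOpenMap_coe _ isOpen_Ioo

lemma measurableSet_image_Ico {a b : ℝ} (hab : a < b) :
    MeasurableSet (((↑) : ℝ → UnitAddCircle) '' Set.Ico a b) := by
  rw [← Set.Ioo_insert_left hab, Set.image_insert_eq]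
  exact (isOpen_image_Ioo a b).measurableSet.insert _

lemma haarAddCircle_real_image_Ico {a b : ℝ} (ha : 0 ≤ a) (hab : a < b) (hb : b ≤ 1) :
    haarAddCircle.real (((↑) : ℝ → UnitAddCircle) '' Set.Ico a b) = b - a := by
  have hsub : Set.Ico a b ⊆ Set.Ico 0 1 := Set.Ico_subset_Ico ha hb
  have hpre : ((↑) : ℝ → UnitAddCircle) ⁻¹' (((↑) : ℝ → UnitAddCircle) '' Set.Ico a b) ∩
      Set.Ico 0 1 = Set.Ico a b := by
    ext y
    simp only [Set.mem_inter_iff, Set.mem_preimage, coe_mem_image_iff_fract_mem hsub]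
    refine ⟨fun h => ?_, fun h => ⟨?_, hsub h⟩⟩
    · rw [← Int.fract_eq_self.2 h.2]
      exact h.1
    · rwa [Int.fract_eq_self.2 (hsub h)]
  rw [haarAddCircle_eq_volume, measureReal_def,
    ← (UnitAddCircle.measurePreserving_mk 0).measure_preimage
      (measurableSet_image_Ico hab).nullMeasurableSet, zero_add, ← restrict_Ico_eq_restrict_Ioc,
    Measure.restrict_apply' measurableSet_Ico, hpre, Real.volume_Ico,
    ENNReal.toReal_ofReal (by linarith)]

lemma haarAddCircle_frontier_image_Ico (a b : ℝ) :
    haarAddCircle (frontier (((↑) : ℝ → UnitAddCircle) '' Set.Ico a b)) = 0 := by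
  have hsub : frontier (((↑) : ℝ → UnitAddCircle) '' Set.Ico a b) ⊆
      ((↑) : ℝ → UnitAddCircle) '' {a, b} := by
    intro t ht
    obtain ⟨y, hy, rfl⟩ := closure_minimal (Set.image_mono Set.Ico_subset_Icc_self)
      (isCompact_image_Icc a b).isClosed ht.1
    refine ⟨y, ?_, rfl⟩
    by_contra hne
    simp only [Set.mem_insert_iff, Set.mem_singleton_iff, not_or] at hne
    exact ht.2 (interior_maximal (Set.image_mono Set.Ioo_subset_Ico_self) (isOpen_image_Ioo a b)
      ⟨y, ⟨lt_of_le_of_ne hy.1 (Ne.symm hne.1), lt_of_le_of_ne hy.2 hne.2⟩, rfl⟩)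
  have hpt (x : UnitAddCircle) : volume {x} = 0 := by
    simpa using volume_closedBall 1 (x := x) 0
  refine measure_mono_null hsub ?_
  rw [Set.image_pair, haarAddCircle_eq_volume, Set.insert_eq]
  exact measure_union_null (hpt _) (hpt _)

/-- (Weyl) For any sequence `(n_k)_{k ≥ 1}` of distinct positive integers, for almost all
`x ∈ [0,1]` the sequence `(⟨n_k x⟩)_{k ≥ 1}` is uniformly distributed modulo 1. -/
theorem weyl_ae_unifDistribMod1 (n : ℕ → ℕ) (hpos : ∀ k, 1 ≤ k → 0 < n k)
    (hinj : ∀ k l, 1 ≤ k → 1 ≤ l → n k = n l → k = l) :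
    ∀ᵐ x ∂(volume.restrict (Set.Icc (0 : ℝ) 1)),
      UnifDistribMod1 (fun k : ℕ => Int.fract ((n k : ℝ) * x)) := by
  have hall : ∀ᵐ t : UnitAddCircle, ∀ m : ℤ, m ≠ 0 →
      Tendsto (fun N : ℕ => (∑ k ∈ Icc 1 N, fourier m (n k • t)) / (N : ℂ)) atTop (𝓝 0) := by
    rw [← haarAddCircle_eq_volume, ae_all_iff]
    intro m
    by_cases hm : m = 0
    · simp [hm]
    have hinj' : Set.InjOn (fun k => m * (n k : ℤ)) (Set.Ici 1) := fun k hk l hl hkl =>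
      hinj k l hk hl (by exact_mod_cast mul_left_cancel₀ hm hkl)
    filter_upwards [ae_tendsto_average_fourier hinj'] with t ht _
    simpa [fourier_apply, mul_smul] using ht
  have hIoc := (UnitAddCircle.measurePreserving_mk 0).quasiMeasurePreserving.ae hall
  rw [zero_add, restrict_Ioc_eq_restrict_Icc] at hIoc
  filter_upwards [hIoc] with x hx a b ha hab hb
  have := tendsto_average_indicator (u := fun k => n k • (x : UnitAddCircle)) hx
    (measurableSet_image_Ico hab) (haarAddCircle_frontier_image_Ico a b)
  rw [haarAddCircle_real_image_Ico ha hab hb] at this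
  refine this.congr fun N => ?_
  congr 1
  refine sum_congr rfl fun k _ => ?_
  have hmem := coe_mem_image_iff_fract_mem (Set.Ico_subset_Ico ha hb) ((n k : ℝ) * x)
  rw [show (((n k : ℝ) * x : ℝ) : UnitAddCircle) = n k • (x : UnitAddCircle) by
    rw [← nsmul_eq_mul, AddCircle.coe_nsmul]] at hmem
  by_cases hk : Int.fract ((n k : ℝ) * x) ∈ Set.Ico a b
  · rw [Set.indicator_of_mem hk, Set.indicator_of_mem (hmem.2 hk)]
  · rw [Set.indicator_of_notMem hk, Set.indicator_of_notMem (mt hmem.1 hk)]
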